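/- For every integer n ≥ 3, the space of sl_2-invariant 2-cocycles of the Heisenberg ideal h_n with values in the adjoint module sch_n has dimension n(n+1)/2; concretely, every such cocycle φ satisfies φ(x_i,x_j)=φ(y_i,y_j)=φ(x_i,z)=φ(y_i,z)=0 and φ(x_i,y_j)=γ_{i,j} z with γ_{i,j}=γ_{j,i}, for some scalars γ_{i,j}. -/

import Mathlib

open scoped BigOperators

/-- Basis index set for the `n`-th Schrödinger algebra
`sch_n = span {h, e, f, x_1, …, x_n, y_1, …, y_n, z}`. -/
inductive SchIdx (n : ℕ) : Type
  | H : SchIdx n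
  | E : SchIdx n
  | F : SchIdx n
  | X : Fin n → SchIdx n
  | Y : Fin n → SchIdx n
  | Z : SchIdx n
  deriving DecidableEq

/-- The underlying vector space of the `n`-th Schrödinger algebra. -/
abbrev Sch (n : ℕ) : Type := SchIdx n → ℂ

/-- The Lie bracket of `sch_n`, written componentwise with respect to the basis;
it encodes exactly the relations `[e,f]=h, [h,e]=2e, [h,f]=-2f, [x_i,y_i]=z,
[h,x_i]=x_i, [h,y_i]=-y_i, [e,y_i]=x_i, [f,x_i]=y_i`. -/
noncomputable def br {n : ℕ} (u v : Sch n) : Sch n := fun j =>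
  match j with
  | .H => u .E * v .F - u .F * v .E
  | .E => 2 * (u .H * v .E - u .E * v .H)
  | .F => -2 * (u .H * v .F - u .F * v .H)
  | .X i => (u .H * v (.X i) - u (.X i) * v .H) + (u .E * v (.Y i) - u (.Y i) * v .E)
  | .Y i => -(u .H * v (.Y i) - u (.Y i) * v .H) + (u .F * v (.X i) - u (.X i) * v .F)
  | .Z => ∑ i : Fin n, (u (.X i) * v (.Y i) - u (.Y i) * v (.X i))

/-- The bracket of `sch_n` as a bilinear map. -/
noncomputable def brL (n : ℕ) : Sch n →ₗ[ℂ] Sch n →ₗ[ℂ] Sch n :=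
  LinearMap.mk₂ ℂ br
    (by
      intro m m' v; funext j; cases j <;> simp only [br, Pi.add_apply]
      case Z => rw [← Finset.sum_add_distrib]; exact Finset.sum_congr rfl fun i _ => by ring
      all_goals ring)
    (by
      intro c m v; funext j; cases j <;> simp only [br, Pi.smul_apply, smul_eq_mul]
      case Z => rw [Finset.mul_sum]; exact Finset.sum_congr rfl fun i _ => by ring
      all_goals ring)
    (by
      intro m v v'; funext j; cases j <;> simp only [br, Pi.add_apply]
      case Z => rw [← Finset.sum_add_distrib]; exact Finset.sum_congr rfl fun i _ => by ring
      all_goals ring)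
    (by
      intro c m v; funext j; cases j <;> simp only [br, Pi.smul_apply, smul_eq_mul]
      case Z => rw [Finset.mul_sum]; exact Finset.sum_congr rfl fun i _ => by ring
      all_goals ring)

/-- The basis vector `h`. -/
noncomputable def hV (n : ℕ) : Sch n := Pi.single SchIdx.H 1
/-- The basis vector `e`. -/
noncomputable def eV (n : ℕ) : Sch n := Pi.single SchIdx.E 1
/-- The basis vector `f`. -/
noncomputable def fV (n : ℕ) : Sch n := Pi.single SchIdx.F 1
/-- The central basis vector `z`. -/
noncomputable def zV (n : ℕ) : Sch n := Pi.single SchIdx.Z 1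
/-- The basis vector `x_i`. -/
noncomputable def xV {n : ℕ} (i : Fin n) : Sch n := Pi.single (SchIdx.X i) 1
/-- The basis vector `y_i`. -/
noncomputable def yV {n : ℕ} (i : Fin n) : Sch n := Pi.single (SchIdx.Y i) 1

/-- The subalgebra `sl_2 = span {e, f, h}` of `sch_n`. -/
noncomputable def sl2 (n : ℕ) : Submodule ℂ (Sch n) :=
  Submodule.span ℂ {eV n, fV n, hV n}
/-- Basis index set for the Heisenberg ideal `h_n = span {x_1, …, x_n, y_1, …, y_n, z}`. -/
inductive HIdx (n : ℕ) : Type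
  | X : Fin n → HIdx n
  | Y : Fin n → HIdx n
  | Z : HIdx n
  deriving DecidableEq

/-- The underlying vector space of the Heisenberg ideal `h_n` of `sch_n`. -/
abbrev Heis (n : ℕ) : Type := HIdx n → ℂ

/-- The natural inclusion `h_n → sch_n`. -/
noncomputable def ιH {n : ℕ} (a : Heis n) : Sch n := fun j =>
  match j with
  | .X i => a (.X i)
  | .Y i => a (.Y i)
  | .Z => a .Z
  | .H => 0
  | .E => 0
  | .F => 0

/-- The action of `v ∈ sch_n` on the ideal `h_n`: `act v a = [v, a]`, viewed inside `h_n`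
(the ideal `h_n` is stable under taking brackets with any element). -/
noncomputable def act {n : ℕ} (v : Sch n) (a : Heis n) : Heis n := fun j =>
  match j with
  | .X i => brL n v (ιH a) (SchIdx.X i)
  | .Y i => brL n v (ιH a) (SchIdx.Y i)
  | .Z => brL n v (ιH a) SchIdx.Z

/-- The bracket of the Heisenberg algebra `h_n`. -/
noncomputable def brH {n : ℕ} (a b : Heis n) : Heis n := act (ιH a) b

/-- The basis vector `x_i` of `h_n`. -/
noncomputable def xH {n : ℕ} (i : Fin n) : Heis n := Pi.single (HIdx.X i) 1
/-- The basis vector `y_i` of `h_n`. -/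
noncomputable def yH {n : ℕ} (i : Fin n) : Heis n := Pi.single (HIdx.Y i) 1
/-- The basis vector `z` of `h_n`. -/
noncomputable def zH (n : ℕ) : Heis n := Pi.single HIdx.Z 1
noncomputable instance (n : ℕ) : AddCommGroup (Heis n →ₗ[ℂ] Heis n →ₗ[ℂ] Sch n) :=
  LinearMap.addCommGroup

noncomputable instance (n : ℕ) : Module ℂ (Heis n →ₗ[ℂ] Heis n →ₗ[ℂ] Sch n) :=
  LinearMap.module
/-- The space of `sl_2`-invariant 2-cocycles of the Heisenberg ideal `h_n` with values in
the adjoint module `sch_n`: alternating bilinear maps `φ : h_n × h_n → sch_n` with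
`[a,φ(b,c)] + [b,φ(c,a)] + [c,φ(a,b)] + φ(a,[b,c]) + φ(b,[c,a]) + φ(c,[a,b]) = 0` and
`[v,φ(a,b)] - φ([v,a],b) - φ(a,[v,b]) = 0` for all `v ∈ sl_2`. -/
noncomputable def adjInvZ2Heis (n : ℕ) : Submodule ℂ (Heis n →ₗ[ℂ] Heis n →ₗ[ℂ] Sch n) where
  carrier := {φ | (∀ a, φ a a = 0) ∧
    (∀ a b c, brL n (ιH a) (φ b c) + brL n (ιH b) (φ c a) + brL n (ιH c) (φ a b) +
      φ a (brH b c) + φ b (brH c a) + φ c (brH a b) = 0) ∧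
    ∀ v ∈ sl2 n, ∀ a b, brL n v (φ a b) - φ (act v a) b - φ a (act v b) = 0}
  add_mem' := by
    rintro φ ψ ⟨hφ1, hφ2, hφ3⟩ ⟨hψ1, hψ2, hψ3⟩
    refine ⟨fun a => ?_, fun a b c => ?_, fun v hv a b => ?_⟩
    · simp only [LinearMap.add_apply, hφ1 a, hψ1 a, add_zero]
    · simp only [LinearMap.add_apply, map_add]
      linear_combination hφ2 a b c + hψ2 a b c
    · simp only [LinearMap.add_apply, map_add]
      linear_combination hφ3 v hv a b + hψ3 v hv a b
  zero_mem' := ⟨fun a => rfl, fun a b c => by simp, fun v hv a b => by simp⟩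
  smul_mem' := by
    rintro c φ ⟨hφ1, hφ2, hφ3⟩
    refine ⟨fun a => ?_, fun a b c' => ?_, fun v hv a b => ?_⟩
    · simp only [LinearMap.smul_apply, hφ1 a, smul_zero]
    · simp only [LinearMap.smul_apply, map_smul]
      simp only [← smul_add]
      rw [hφ2 a b c', smul_zero]
    · simp only [LinearMap.smul_apply, map_smul]
      simp only [← smul_sub]
      rw [hφ3 v hv a b, smul_zero]

instance (n : ℕ) : Finite (HIdx n) :=
  Finite.of_surjective
    (fun t : Option (Fin n ⊕ Fin n) => match t with
      | none => HIdx.Z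
      | some (Sum.inl i) => HIdx.X i
      | some (Sum.inr i) => HIdx.Y i)
    (by
      rintro (i | i | _)
      exacts [⟨some (Sum.inl i), rfl⟩, ⟨some (Sum.inr i), rfl⟩, ⟨none, rfl⟩])

section Action

variable {n : ℕ}

lemma brL_apply (u v : Sch n) : brL n u v = br u v := rfl

lemma act_hV_xH (i : Fin n) : act (hV n) (xH i) = xH i := by
  funext k; cases k <;> simp [act, brL_apply, br, ιH, hV, xH, Pi.single_apply]

lemma act_hV_yH (i : Fin n) : act (hV n) (yH i) = -yH i := by
  funext k; cases k <;> simp [act, brL_apply, br, ιH, hV, yH, Pi.single_apply]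

lemma act_eV_xH (i : Fin n) : act (eV n) (xH i) = 0 := by
  funext k; cases k <;> simp [act, brL_apply, br, ιH, eV, xH, Pi.single_apply]

lemma act_eV_yH (i : Fin n) : act (eV n) (yH i) = xH i := by
  funext k; cases k <;> simp [act, brL_apply, br, ιH, eV, xH, yH, Pi.single_apply]

lemma act_fV_xH (i : Fin n) : act (fV n) (xH i) = yH i := by
  funext k; cases k <;> simp [act, brL_apply, br, ιH, fV, xH, yH, Pi.single_apply]

lemma act_fV_yH (i : Fin n) : act (fV n) (yH i) = 0 := by
  funext k; cases k <;> simp [act, brL_apply, br, ιH, fV, yH, Pi.single_apply]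

lemma act_fV_zH : act (fV n) (zH n) = 0 := by
  funext k; cases k <;> simp [act, brL_apply, br, ιH, fV, zH]

lemma brH_xH_xH (i j : Fin n) : brH (xH i) (xH j) = 0 := by
  funext k; cases k <;> simp [brH, act, brL_apply, br, ιH, xH, Pi.single_apply]

lemma brH_xH_yH (i j : Fin n) : brH (xH i) (yH j) = if i = j then zH n else 0 := by
  split_ifs with hij <;> funext k <;> cases k <;>
    simp [brH, act, brL_apply, br, ιH, xH, yH, zH, Pi.single_apply, hij, eq_comm]

lemma brH_yH_xH (i j : Fin n) : brH (yH i) (xH j) = if i = j then -zH n else 0 := by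
  split_ifs with hij <;> funext k <;> cases k <;>
    simp [brH, act, brL_apply, br, ιH, xH, yH, zH, Pi.single_apply, hij, eq_comm]

lemma br_zV (u : Sch n) (c : ℂ) : brL n u (c • zV n) = 0 := by
  funext k; cases k <;> simp [brL_apply, br, zV]

lemma eV_mem_sl2 : eV n ∈ sl2 n := Submodule.subset_span (by simp)

lemma fV_mem_sl2 : fV n ∈ sl2 n := Submodule.subset_span (by simp)

lemma hV_mem_sl2 : hV n ∈ sl2 n := Submodule.subset_span (by simp)

lemma apply_eq_zero_of_mem_sl2 {v : Sch n} (hv : v ∈ sl2 n) (i : Fin n) :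
    v (.X i) = 0 ∧ v (.Y i) = 0 := by
  induction hv using Submodule.span_induction with
  | mem v hv =>
    rcases hv with rfl | rfl | rfl <;> simp [eV, fV, hV]
  | zero => simp
  | add u v _ _ hu hv => simp [hu.1, hu.2, hv.1, hv.2]
  | smul c v _ hv => simp [hv.1, hv.2]

end Action

/-- Every `sl_2`-invariant adjoint 2-cocycle of `h_n` is given on basis vectors by a symmetric
matrix of scalars. -/
lemma exists_symm_of_mem_adjInvZ2Heis {n : ℕ} (hn : 3 ≤ n)
    {φ : Heis n →ₗ[ℂ] Heis n →ₗ[ℂ] Sch n} (hφ : φ ∈ adjInvZ2Heis n) :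
    ∃ γ : Fin n → Fin n → ℂ,
      (∀ i j, γ i j = γ j i) ∧
      (∀ i j, φ (xH i) (yH j) = γ i j • zV n) ∧
      (∀ i j, φ (xH i) (xH j) = 0) ∧
      (∀ i j, φ (yH i) (yH j) = 0) ∧
      (∀ i, φ (xH i) (zH n) = 0) ∧
      (∀ i, φ (yH i) (zH n) = 0) := by
  obtain ⟨halt, hcoc, hinv⟩ := hφ
  have hanti : ∀ a b, φ a b = -φ b a := fun a b =>
    (LinearMap.IsAlt.neg (B := φ) halt b a).symm
  have hXXE : ∀ i j, φ (xH i) (xH j) = φ (xH i) (xH j) .E • eV n := fun i j => by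
    have h := hinv _ hV_mem_sl2 (xH i) (xH j)
    rw [act_hV_xH, act_hV_xH, brL_apply] at h
    funext k
    have hk := congrFun h k
    cases k <;>
      simp [br, hV, eV] at hk ⊢ <;> grind
  have hXYHZ : ∀ i j,
      φ (xH i) (yH j) = φ (xH i) (yH j) .H • hV n + φ (xH i) (yH j) .Z • zV n := fun i j => by
    have h := hinv _ hV_mem_sl2 (xH i) (yH j)
    rw [act_hV_xH, act_hV_yH, brL_apply] at h
    funext k
    have hk := congrFun h k
    cases k <;>
      simp [br, hV, zV] at hk ⊢ <;> grind
  have hHE : ∀ i j, -2 * φ (xH i) (yH j) .H = φ (xH i) (xH j) .E := fun i j => by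
    have h := hinv _ eV_mem_sl2 (xH i) (yH j)
    rw [act_eV_xH, act_eV_yH, brL_apply] at h
    have hk := congrFun h .E
    simp [br, eV] at hk
    linear_combination hk
  have hsymm : ∀ i j, φ (xH i) (yH j) .Z = φ (xH j) (yH i) .Z := fun i j => by
    have h := hinv _ fV_mem_sl2 (xH i) (xH j)
    rw [act_fV_xH, act_fV_xH, brL_apply, hanti (yH i)] at h
    have hk := congrFun h .Z
    simp [br, fV] at hk
    linear_combination -hk
  have hE : ∀ i j, φ (xH i) (xH j) .E = 0 := fun i j => by
    rcases eq_or_ne i j with rfl | hij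
    · simp [halt]
    obtain ⟨k, hk⟩ : ∃ k, k ∉ ({i, j} : Finset (Fin n)) := by
      by_contra! hall
      have h1 := Finset.card_le_card (fun k _ => hall k : Finset.univ ⊆ ({i, j} : Finset (Fin n)))
      have h2 := Finset.card_le_two (a := i) (b := j)
      simp only [Finset.card_univ, Fintype.card_fin] at h1
      omega
    simp only [Finset.mem_insert, Finset.mem_singleton, not_or] at hk
    have h := hcoc (xH i) (xH j) (yH k)
    rw [brH_xH_yH, brH_yH_xH, brH_xH_xH, if_neg (Ne.symm hk.2), if_neg hk.1] at h
    have h' := congrFun h (.X k)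
    simpa [brL_apply, br, ιH, xH, yH, Pi.single_apply, hk.1, hk.2] using h'
  have hXX : ∀ i j, φ (xH i) (xH j) = 0 := fun i j => by rw [hXXE, hE, zero_smul]
  have hXY : ∀ i j, φ (xH i) (yH j) = φ (xH i) (yH j) .Z • zV n := fun i j => by
    have h0 : φ (xH i) (yH j) .H = 0 := by
      linear_combination (-1 / 2 : ℂ) * (hHE i j + hE i j)
    have h := hXYHZ i j
    rwa [h0, zero_smul, zero_add] at h
  have hXZ : ∀ i, φ (xH i) (zH n) = 0 := fun i => by
    have : Nontrivial (Fin n) := Fin.nontrivial_iff_two_le.2 (by omega)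
    obtain ⟨j, hj⟩ := exists_ne i
    have h := hcoc (xH i) (xH j) (yH j)
    rw [brH_xH_yH, brH_yH_xH, brH_xH_xH, if_pos rfl, if_neg hj, hXX, hanti (yH j), hXY j j,
      hXY i j, map_neg, br_zV, br_zV] at h
    simpa using h
  refine ⟨fun i j => φ (xH i) (yH j) .Z, hsymm, hXY, hXX, fun i j => ?_, hXZ, fun i => ?_⟩
  · have h := hinv _ fV_mem_sl2 (xH i) (yH j)
    rw [act_fV_xH, act_fV_yH, hXY, br_zV] at h
    simpa using h
  · have h := hinv _ fV_mem_sl2 (xH i) (zH n)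
    rw [act_fV_xH, act_fV_zH, hXZ] at h
    simpa using h

/-- The alternating form on `h_n` with values in the centre attached to a symmetric matrix. -/
noncomputable def centralForm (n : ℕ) :
    (Sym2 (Fin n) → ℂ) →ₗ[ℂ] Heis n →ₗ[ℂ] Heis n →ₗ[ℂ] Sch n where
  toFun g := LinearMap.mk₂ ℂ
    (fun a b => (∑ i, ∑ j, g s(i, j) * (a (.X i) * b (.Y j) - a (.Y i) * b (.X j))) • zV n)
    (fun a a' b => by
      simp only [← add_smul, ← Finset.sum_add_distrib, Pi.add_apply]
      congr 1
      exact Finset.sum_congr rfl fun i _ => Finset.sum_congr rfl fun j _ => by ring)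
    (fun c a b => by
      simp only [smul_smul, Finset.mul_sum, Pi.smul_apply, smul_eq_mul]
      congr 1
      exact Finset.sum_congr rfl fun i _ => Finset.sum_congr rfl fun j _ => by ring)
    (fun a b b' => by
      simp only [← add_smul, ← Finset.sum_add_distrib, Pi.add_apply]
      congr 1
      exact Finset.sum_congr rfl fun i _ => Finset.sum_congr rfl fun j _ => by ring)
    (fun c a b => by
      simp only [smul_smul, Finset.mul_sum, Pi.smul_apply, smul_eq_mul]
      congr 1
      exact Finset.sum_congr rfl fun i _ => Finset.sum_congr rfl fun j _ => by ring)
  map_add' g g' := LinearMap.ext₂ fun a b => by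
    simp only [LinearMap.add_apply, LinearMap.mk₂_apply, ← add_smul, ← Finset.sum_add_distrib,
      Pi.add_apply, add_mul]
  map_smul' c g := LinearMap.ext₂ fun a b => by
    simp only [LinearMap.smul_apply, LinearMap.mk₂_apply, smul_smul, Finset.mul_sum,
      Pi.smul_apply, smul_eq_mul, RingHom.id_apply, mul_assoc]

section CentralForm

variable {n : ℕ}

lemma centralForm_apply (g : Sym2 (Fin n) → ℂ) (a b : Heis n) :
    centralForm n g a b =
      (∑ i, ∑ j, g s(i, j) * (a (.X i) * b (.Y j) - a (.Y i) * b (.X j))) • zV n := rfl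

lemma centralForm_swap (g : Sym2 (Fin n) → ℂ) (a b : Heis n) :
    centralForm n g a b = -centralForm n g b a := by
  rw [centralForm_apply, centralForm_apply, ← neg_smul, Finset.sum_comm]
  simp only [← Finset.sum_neg_distrib]
  congr 1
  refine Finset.sum_congr rfl fun j _ => Finset.sum_congr rfl fun i _ => ?_
  rw [Sym2.eq_swap]
  ring

lemma centralForm_self (g : Sym2 (Fin n) → ℂ) (a : Heis n) : centralForm n g a a = 0 :=
  self_eq_neg.1 (centralForm_swap g a a)

lemma centralForm_xH_yH (g : Sym2 (Fin n) → ℂ) (i j : Fin n) :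
    centralForm n g (xH i) (yH j) = g s(i, j) • zV n := by
  simp [centralForm_apply, xH, yH, Pi.single_apply]

lemma centralForm_brH (g : Sym2 (Fin n) → ℂ) (a b c : Heis n) :
    centralForm n g a (brH b c) = 0 := by
  simp [centralForm_apply, brH, act, brL_apply, br, ιH]

lemma centralForm_act (g : Sym2 (Fin n) → ℂ) {v : Sch n} (hv : v ∈ sl2 n) (a b : Heis n) :
    centralForm n g (act v a) b + centralForm n g a (act v b) = 0 := by
  rw [centralForm_apply, centralForm_apply, ← add_smul]
  simp only [← Finset.sum_add_distrib]
  convert zero_smul ℂ (zV n)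
  refine Finset.sum_eq_zero fun i _ => Finset.sum_eq_zero fun j _ => ?_
  simp only [act, brL_apply, br, ιH, (apply_eq_zero_of_mem_sl2 hv _).1,
    (apply_eq_zero_of_mem_sl2 hv _).2]
  ring

lemma centralForm_mem (g : Sym2 (Fin n) → ℂ) : centralForm n g ∈ adjInvZ2Heis n := by
  refine ⟨centralForm_self g, fun a b c => ?_, fun v hv a b => ?_⟩
  · simp only [centralForm_brH]
    simp only [centralForm_apply, br_zV, add_zero]
  · rw [sub_sub, centralForm_act g hv, centralForm_apply, br_zV, sub_zero]

lemma centralForm_injective : Function.Injective (centralForm n) := by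
  intro g g' h
  funext s
  induction s with | _ i j
  have hij := congrFun (LinearMap.congr_fun₂ h (xH i) (yH j)) .Z
  simpa [centralForm_xH_yH, zV] using hij

lemma Heis.hom_ext {M : Type*} [AddCommMonoid M] [Module ℂ M] {f g : Heis n →ₗ[ℂ] M}
    (hx : ∀ i, f (xH i) = g (xH i)) (hy : ∀ i, f (yH i) = g (yH i))
    (hz : f (zH n) = g (zH n)) : f = g := by
  refine LinearMap.pi_ext' fun k => LinearMap.ext_ring ?_
  cases k
  exacts [hx _, hy _, hz]

lemma range_centralForm (hn : 3 ≤ n) : LinearMap.range (centralForm n) = adjInvZ2Heis n := by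
  refine le_antisymm ?_ fun φ hφ => ?_
  · rintro _ ⟨g, rfl⟩
    exact centralForm_mem g
  obtain ⟨γ, hγ, hxy, hxx, hyy, hxz, hyz⟩ := exists_symm_of_mem_adjInvZ2Heis hn hφ
  have hanti : ∀ a b, φ a b = -φ b a := fun a b =>
    (LinearMap.IsAlt.neg (B := φ) hφ.1 b a).symm
  let g : Sym2 (Fin n) → ℂ := Sym2.lift ⟨γ, hγ⟩
  have gxy : ∀ i j, centralForm n g (xH i) (yH j) = γ i j • zV n := centralForm_xH_yH g
  refine ⟨g, ?_⟩
  refine Heis.hom_ext (fun i => Heis.hom_ext (fun j => ?_) (fun j => ?_) ?_)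
    (fun i => Heis.hom_ext (fun j => ?_) (fun j => ?_) ?_)
    (Heis.hom_ext (fun j => ?_) (fun j => ?_) ?_)
  · rw [hxx]; simp [centralForm_apply, xH]
  · rw [hxy, gxy]
  · rw [hxz]; simp [centralForm_apply, xH, zH]
  · rw [hanti, centralForm_swap, hxy, gxy]
  · rw [hyy]; simp [centralForm_apply, yH]
  · rw [hyz]; simp [centralForm_apply, yH, zH]
  · rw [hanti, hxz]; simp [centralForm_apply, xH, zH]
  · rw [hanti, hyz]; simp [centralForm_apply, yH, zH]
  · rw [hφ.1, centralForm_self]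

end CentralForm

/-- **For every `n ≥ 3`, the space of `sl_2`-invariant 2-cocycles of `h_n` with values in
the adjoint module `sch_n` has dimension `n(n+1)/2`; concretely, every such cocycle `φ`
satisfies `φ(x_i,x_j) = φ(y_i,y_j) = φ(x_i,z) = φ(y_i,z) = 0` and `φ(x_i,y_j) = γ_{i,j} z`
with `γ_{i,j} = γ_{j,i}` for some scalars `γ_{i,j}`.** -/
theorem adjInvZ2Heis_description (n : ℕ) (hn : 3 ≤ n) :
    Module.finrank ℂ ↥(adjInvZ2Heis n) = n * (n + 1) / 2 ∧
      ∀ φ ∈ adjInvZ2Heis n, ∃ γ : Fin n → Fin n → ℂ,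
        (∀ i j, γ i j = γ j i) ∧
        (∀ i j, φ (xH i) (yH j) = γ i j • zV n) ∧
        (∀ i j, φ (xH i) (xH j) = 0) ∧
        (∀ i j, φ (yH i) (yH j) = 0) ∧
        (∀ i, φ (xH i) (zH n) = 0) ∧
        (∀ i, φ (yH i) (zH n) = 0) := by
  refine ⟨?_, fun φ hφ => exists_symm_of_mem_adjInvZ2Heis hn hφ⟩
  rw [← range_centralForm hn, LinearMap.finrank_range_of_inj centralForm_injective,
    Module.finrank_fintype_fun_eq_card, Sym2.card, Fintype.card_fin, Nat.choose_two_right,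
    Nat.add_sub_cancel, mul_comm]
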